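/- arXiv:1207.6479 — 4 statements merged into one kernel-verified Lean document; each statement's English description precedes it below -/
import Mathlib

section
/- Let q = p^e be a prime power and let r be a positive integer. Then there exists a positive integer d_r such that for every integer d ≥ d_r and every integer j with 1 ≤ j ≤ r, the power sum ∑_{a ∈ A_{<d}} a^j equals 0 in A = 𝔽_q[T]. -/
open Polynomial

theorem sum_prod_coord_eq_zero {F : Type*} [Field F] [Fintype F] {d j : ℕ} (h : j < d)
    (f : Fin j → Fin d) : ∑ c : Fin d → F, ∏ k, c (f k) = 0 := by
  have hdeg : (∏ k, MvPolynomial.X (R := F) (f k)).totalDegree < (Fintype.card F - 1) *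
      Fintype.card (Fin d) := by
    have hq : 1 ≤ Fintype.card F - 1 := Nat.le_sub_one_of_lt Fintype.one_lt_card
    calc (∏ k, MvPolynomial.X (R := F) (f k)).totalDegree
        ≤ ∑ k, (MvPolynomial.X (R := F) (f k)).totalDegree :=
          MvPolynomial.totalDegree_finsetProd _ _
      _ = j := by simp
      _ < (Fintype.card F - 1) * Fintype.card (Fin d) := by
          rw [Fintype.card_fin]; nlinarith
  classical
  simpa [MvPolynomial.eval_prod] using MvPolynomial.sum_eval_eq_zero _ hdeg

theorem sum_linearCombination_pow_eq_zero {F R : Type*} [Field F] [Fintype F] [CommRing R]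
    [Algebra F R] {d j : ℕ} (h : j < d) (v : Fin d → R) :
    ∑ c : Fin d → F, (∑ i, algebraMap F R (c i) * v i) ^ j = 0 := by
  simp_rw [← Fin.prod_const j, Finset.prod_univ_sum]
  rw [Finset.sum_comm]
  refine Finset.sum_eq_zero fun f _ => ?_
  simp_rw [Finset.prod_mul_distrib, ← map_prod]
  rw [← Finset.sum_mul, ← map_sum, sum_prod_coord_eq_zero h, map_zero, zero_mul]

theorem finsum_degree_lt_pow_eq_zero {F : Type*} [Field F] [Fintype F] {d j : ℕ} (h : j < d) :
    (∑ᶠ a ∈ {a : Polynomial F | a.degree < (d : WithBot ℕ)}, a ^ j) = 0 := by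
  rw [← sum_linearCombination_pow_eq_zero (F := F) h fun i => (X : F[X]) ^ (i : ℕ),
    ← finsum_eq_sum_of_fintype,
    ← finsum_mem_univ fun c : Fin d → F => (∑ i, algebraMap F F[X] (c i) * X ^ (i : ℕ)) ^ j]
  symm
  let φ := degreeLTEquiv F d
  refine finsum_mem_eq_of_bijOn (fun c => (φ.symm c : F[X])) ⟨?_, ?_, ?_⟩ ?_
  · intro c _
    exact mem_degreeLT.1 (φ.symm c).2
  · intro c _ c' _ hc
    exact φ.symm.injective (Subtype.ext hc)
  · intro a ha
    exact ⟨φ ⟨a, mem_degreeLT.2 ha⟩, trivial, by simp⟩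
  · intro c _
    congr 1
    simp [φ, degreeLTEquiv, ← C_mul_X_pow_eq_monomial]

/-- Let `q = p^e` be a prime power and `r` a positive integer. Then there
exists a positive integer `d_r` such that for all `d ≥ d_r` and all `1 ≤ j ≤ r`, the power
sum `∑_{a ∈ A_{<d}} a^j` vanishes in `A = 𝔽_q[T]`. -/
theorem power_sum_vanishing (p e : ℕ) (hp : p.Prime) (he : 0 < e)
    (F : Type*) [Field F] [Fintype F] (hcard : Fintype.card F = p ^ e)
    (r : ℕ) (hr : 0 < r) :
    ∃ dr : ℕ, 0 < dr ∧ ∀ d : ℕ, dr ≤ d → ∀ j : ℕ, 1 ≤ j → j ≤ r →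
      (∑ᶠ a ∈ {a : Polynomial F | a.degree < (d : WithBot ℕ)}, a ^ j) = 0 :=
  ⟨r + 1, r.succ_pos, fun _ hd _ _ hj => finsum_degree_lt_pow_eq_zero (by omega)⟩
end

section
/- Let q = p^e be a prime power, let j be a positive integer with (q−1) ∤ j, and let d ≥ 0 be any integer. Then ∑_{a ∈ A_{<d}} a^j = 0 in A = 𝔽_q[T]. -/
open Polynomial

/-- A sum of `j`-th powers over a set stable under scaling by units vanishes as soon as some
unit `u` has `u ^ j ≠ 1`. -/
theorem finsum_mem_pow_eq_zero_of_smul_mem {F R : Type*} [Field F] [CommRing R] [Algebra F R]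
    {s : Set R} (hs : ∀ (c : Fˣ), ∀ a ∈ s, c • a ∈ s) {j : ℕ} {u : Fˣ} (hu : u ^ j ≠ 1) :
    ∑ᶠ a ∈ s, a ^ j = 0 := by
  have hbij : Set.BijOn (fun a : R => u • a) s s :=
    ⟨hs u, (MulAction.injective u).injOn, fun a ha => ⟨u⁻¹ • a, hs u⁻¹ a ha, smul_inv_smul u a⟩⟩
  have hsum : ∑ᶠ a ∈ s, ((u : F) ^ j) • a ^ j = ∑ᶠ a ∈ s, a ^ j :=
    finsum_mem_eq_of_bijOn _ hbij fun a _ => by rw [Units.smul_def, _root_.smul_pow]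
  have hfix : ((u : F) ^ j) • ∑ᶠ a ∈ s, a ^ j = ∑ᶠ a ∈ s, a ^ j := by
    rw [smul_finsum, ← hsum]
    simp only [smul_finsum]
  have hne : (u : F) ^ j - 1 ≠ 0 :=
    sub_ne_zero.2 fun h => hu (Units.ext (by simpa using h))
  have hzero : ((u : F) ^ j - 1) • ∑ᶠ a ∈ s, a ^ j = 0 := by
    rw [sub_smul, one_smul, hfix, sub_self]
  exact (smul_eq_zero.1 hzero).resolve_left hne

/-- Let `q = p^e` be a prime power, `j` a positive integer not divisible by
`q - 1`, and `d ≥ 0`. Then `∑_{a ∈ A_{<d}} a^j = 0` in `A = 𝔽_q[T]`. -/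
theorem power_sum_vanishing_of_not_dvd (p e : ℕ) (hp : p.Prime) (he : 0 < e)
    (F : Type*) [Field F] [Fintype F] (hcard : Fintype.card F = p ^ e)
    (j : ℕ) (hj : 0 < j) (hndvd : ¬ (p ^ e - 1) ∣ j) (d : ℕ) :
    (∑ᶠ a ∈ {a : Polynomial F | a.degree < (d : WithBot ℕ)}, a ^ j) = 0 := by
  rw [← hcard, ← FiniteField.forall_pow_eq_one_iff F j, not_forall] at hndvd
  obtain ⟨u, hu⟩ := hndvd
  exact finsum_mem_pow_eq_zero_of_smul_mem
    (fun c a ha => (degree_smul_le (c : F) a).trans_lt ha) hu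
end

section
/- Let q = p^e be a prime power and let k, n be positive integers with k ≥ 2n, (q − 1) ∣ (k − 2n), and n ≤ p^{v_p(k−n)}. Let d ≥ 1 be an integer such that ∑_{a ∈ A_{<d}} a^j = 0 for every integer j with 1 ≤ j ≤ k − 2n. Let L be a field extension of the rational function field 𝔽_q(T) and let z ∈ L be transcendental over 𝔽_q(T). Then, regarding elements of A = 𝔽_q[T] as elements of L, the finite sum ∑_{(u,v) ∈ A_{<d}² \ {(0,0)}} ((v z)^{k−n} − u^{k−n}) / (v z − u)^n equals 0 if k − 2n ≠ 0, and equals −1 if k − 2n = 0. (Every denominator v z − u with (u, v) ≠ (0, 0) is nonzero in L because z is transcendental over 𝔽_q(T).) -/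
open Polynomial

/-- In characteristic `p`, dividing `x ^ (p ^ r * t) - y ^ (p ^ r * t)` by `(x - y) ^ n` with
`n ≤ p ^ r` leaves an explicit homogeneous polynomial in `x` and `y`. -/
lemma pow_sub_pow_div_sub_pow {L : Type*} [Field L] {p : ℕ} [Fact p.Prime] [CharP L p]
    {x y : L} (hxy : x - y ≠ 0) {n r : ℕ} (hnr : n ≤ p ^ r) (t : ℕ) :
    (x ^ (p ^ r * t) - y ^ (p ^ r * t)) / (x - y) ^ n =
      ∑ i ∈ Finset.range t, ∑ j ∈ Finset.range (p ^ r - n + 1),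
        (-1) ^ (p ^ r - n - j) * ((p ^ r - n).choose j : L) *
          (x ^ (p ^ r * i + j) * y ^ (p ^ r * (t - 1 - i) + (p ^ r - n - j))) := by
  have h₁ : x ^ (p ^ r * t) - y ^ (p ^ r * t) =
      (x - y) ^ n * ((x - y) ^ (p ^ r - n) *
        ∑ i ∈ Finset.range t, x ^ (p ^ r * i) * y ^ (p ^ r * (t - 1 - i))) := by
    rw [← mul_assoc, ← pow_add, Nat.add_sub_cancel' hnr, sub_pow_char_pow]
    simp only [pow_mul]
    rw [mul_comm, geom_sum₂_mul]
  rw [h₁, mul_div_cancel_left₀ _ (pow_ne_zero n hxy), Finset.mul_sum]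
  refine Finset.sum_congr rfl fun i _ ↦ ?_
  rw [sub_eq_add_neg, add_pow, Finset.sum_mul]
  refine Finset.sum_congr rfl fun j _ ↦ ?_
  rw [neg_pow y]
  ring

/-- If the power sums over `S` of exponents `1, …, N` vanish, then so do the sums over `S × S`
of all monomials of total degree `N > 0`. -/
lemma sum_product_pow_mul_pow_eq_zero {R L : Type*} [CommRing R] [CommRing L] (φ : R →+* L)
    (S : Finset R) {N : ℕ} (hS : ∀ j, 1 ≤ j → j ≤ N → ∑ a ∈ S, a ^ j = 0) (z : L)
    {a b : ℕ} (hab : a + b = N) (hN : N ≠ 0) :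
    ∑ w ∈ S ×ˢ S, (φ w.2 * z) ^ a * φ w.1 ^ b = 0 := by
  have h : ∑ w ∈ S ×ˢ S, (φ w.2 * z) ^ a * φ w.1 ^ b =
      z ^ a * (φ (∑ u ∈ S, u ^ b) * φ (∑ v ∈ S, v ^ a)) := by
    rw [map_sum, map_sum, Finset.sum_mul_sum, ← Finset.sum_product', Finset.mul_sum]
    refine Finset.sum_congr rfl fun w _ ↦ ?_
    simp only [map_pow]
    ring
  rw [h]
  rcases Nat.eq_zero_or_pos a with ha | ha
  · rw [hS b (by omega) (by omega)]; simp
  · rw [hS a (by omega) (by omega)]; simp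

lemma finite_setOf_degree_lt (F : Type*) [Field F] [Finite F] (d : ℕ) :
    {a : F[X] | a.degree < (d : WithBot ℕ)}.Finite := by
  have : Finite (degreeLT F d) := Finite.of_equiv _ (degreeLTEquiv F d).toEquiv.symm
  have h : {a : F[X] | a.degree < (d : WithBot ℕ)} = (degreeLT F d : Set F[X]) := by
    ext a; simp [mem_degreeLT]
  rw [h]
  exact Set.toFinite _

lemma ncard_setOf_degree_lt (F : Type*) [Field F] [Fintype F] (d : ℕ) :
    {a : F[X] | a.degree < (d : WithBot ℕ)}.ncard = Fintype.card F ^ d := by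
  have h : {a : F[X] | a.degree < (d : WithBot ℕ)} = (degreeLT F d : Set F[X]) := by
    ext a; simp [mem_degreeLT]
  rw [h, ← Nat.card_coe_set_eq]
  exact (Nat.card_congr (degreeLTEquiv F d).toEquiv).trans (by simp)

lemma mul_sub_ne_zero_of_transcendental {F L : Type*} [Field F] [Field L] [Algebra (RatFunc F) L]
    {z : L} (hz : Transcendental (RatFunc F) z) {w : F[X] × F[X]} (hw : w ≠ 0) :
    algebraMap (RatFunc F) L (algebraMap F[X] (RatFunc F) w.2) * z -
      algebraMap (RatFunc F) L (algebraMap F[X] (RatFunc F) w.1) ≠ 0 := by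
  intro h
  set v := algebraMap F[X] (RatFunc F) w.2 with hv
  set u := algebraMap F[X] (RatFunc F) w.1 with hu
  have hroot := (transcendental_iff.mp hz) (C v * X - C u) (by simpa using h)
  have h₁ : v = 0 := by simpa using congrArg (coeff · 1) hroot
  have h₀ : u = 0 := by simpa using congrArg (coeff · 0) hroot
  exact hw (Prod.ext ((map_eq_zero_iff _ (RatFunc.algebraMap_injective F)).mp h₀)
    ((map_eq_zero_iff _ (RatFunc.algebraMap_injective F)).mp h₁))



/-- Lemma 2 of the paper. Let `q = p^e` be a prime power and `k, n`
positive integers with `k ≥ 2n`, `(q-1) ∣ (k-2n)` and `n ≤ p^{v_p(k-n)}`. Let `d ≥ 1` be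
such that `∑_{a ∈ A_{<d}} a^j = 0` for `1 ≤ j ≤ k - 2n`. Let `L` be a field extension of
`𝔽_q(T)` and `z ∈ L` transcendental over `𝔽_q(T)`. Then
`∑'_{(u,v) ∈ A_{<d}²} ((vz)^{k-n} - u^{k-n})/(vz - u)^n` equals `0` if `k - 2n ≠ 0` and
equals `-1` if `k - 2n = 0` (the prime meaning `(u,v) ≠ (0,0)`). -/
theorem lemma_two (p e : ℕ) (hp : p.Prime) (he : 0 < e)
    (F : Type*) [Field F] [Fintype F] (hcard : Fintype.card F = p ^ e)
    (k n : ℕ) (hn : 0 < n) (hk : 2 * n ≤ k)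
    (hmod : (p ^ e - 1) ∣ (k - 2 * n))
    (hval : n ≤ p ^ padicValNat p (k - n))
    (d : ℕ) (hd : 1 ≤ d)
    (hsum : ∀ j : ℕ, 1 ≤ j → j ≤ k - 2 * n →
      (∑ᶠ a ∈ {a : Polynomial F | a.degree < (d : WithBot ℕ)}, a ^ j) = 0)
    (L : Type*) [Field L] [Algebra (RatFunc F) L]
    (z : L) (hz : Transcendental (RatFunc F) z) :
    (∑ᶠ uv ∈ {uv : Polynomial F × Polynomial F |
        uv.1.degree < (d : WithBot ℕ) ∧ uv.2.degree < (d : WithBot ℕ) ∧ uv ≠ 0},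
      ((algebraMap (RatFunc F) L (algebraMap (Polynomial F) (RatFunc F) uv.2) * z) ^ (k - n) -
          algebraMap (RatFunc F) L (algebraMap (Polynomial F) (RatFunc F) uv.1) ^ (k - n)) /
        (algebraMap (RatFunc F) L (algebraMap (Polynomial F) (RatFunc F) uv.2) * z -
          algebraMap (RatFunc F) L (algebraMap (Polynomial F) (RatFunc F) uv.1)) ^ n) =
      if k - 2 * n = 0 then -1 else 0 := by
  classical
  have : Fact p.Prime := ⟨hp⟩
  have : CharP F p := charP_of_card_eq_prime_pow hcard
  have : CharP (RatFunc F) p := charP_of_injective_algebraMap (algebraMap F (RatFunc F)).injective p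
  have : CharP L p := charP_of_injective_algebraMap (algebraMap (RatFunc F) L).injective p
  have hfin := finite_setOf_degree_lt F d
  set S : Finset F[X] := hfin.toFinset with hS
  have hmem (a : F[X]) : a ∈ S ↔ a.degree < (d : WithBot ℕ) := by simp [hS]
  have hcoe : {a : F[X] | a.degree < (d : WithBot ℕ)} = (S : Set F[X]) := by simp [hS]
  have hsumS (j : ℕ) (h₁ : 1 ≤ j) (h₂ : j ≤ k - 2 * n) : ∑ a ∈ S, a ^ j = 0 := by
    rw [← hsum j h₁ h₂, hcoe, finsum_mem_coe_finset]
  have hcardS : S.card = (p ^ e) ^ d := by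
    rw [← hcard, ← ncard_setOf_degree_lt, hcoe, Set.ncard_coe_finset]
  have hset : {uv : F[X] × F[X] | uv.1.degree < (d : WithBot ℕ) ∧
      uv.2.degree < (d : WithBot ℕ) ∧ uv ≠ 0} = (((S ×ˢ S).erase 0 : Finset _) : Set _) := by
    ext w
    simp only [Set.mem_ofPred_eq, Finset.coe_erase, Finset.coe_product, Set.mem_sdiff,
      Set.mem_prod, Finset.mem_coe, hmem, Set.mem_singleton_iff]
    tauto
  have hzero : (0 : F[X] × F[X]) ∈ S ×ˢ S := by
    simp [hmem]
  rw [hset, finsum_mem_coe_finset]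
  set φ : F[X] →+* L := (algebraMap (RatFunc F) L).comp (algebraMap F[X] (RatFunc F)) with hφ
  change ∑ w ∈ (S ×ˢ S).erase 0,
    ((φ w.2 * z) ^ (k - n) - φ w.1 ^ (k - n)) / (φ w.2 * z - φ w.1) ^ n = _
  have hne (w) (hw : w ∈ (S ×ˢ S).erase 0) : φ w.2 * z - φ w.1 ≠ 0 :=
    mul_sub_ne_zero_of_transcendental hz (Finset.ne_of_mem_erase hw)
  obtain ⟨t, ht⟩ : p ^ padicValNat p (k - n) ∣ k - n := pow_padicValNat_dvd
  split_ifs with hN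
  · have hkn : k - n = n := by omega
    rw [Finset.sum_congr rfl (g := fun _ ↦ (1 : L)), Finset.sum_const,
      Finset.card_erase_of_mem hzero, Finset.card_product, hcardS, nsmul_one,
      Nat.cast_sub (Nat.one_le_iff_ne_zero.mpr (by simp [hp.ne_zero]))]
    · simp [he.ne', Nat.one_le_iff_ne_zero.mp hd]
    · intro w hw
      have hle : p ^ padicValNat p (k - n) ≤ k - n := Nat.le_of_dvd (by omega) ⟨t, ht⟩
      have hpow : p ^ padicValNat p (k - n) = n := by omega
      rw [hkn] at hpow ⊢
      rw [← hpow, ← sub_pow_char_pow, div_self (pow_ne_zero _ (hne w hw))]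
  · set s := p ^ padicValNat p (k - n) with hs
    have ht0 : t ≠ 0 := by rintro rfl; omega
    have hexp {i j : ℕ} (hi : i ∈ Finset.range t) (hj : j ∈ Finset.range (s - n + 1)) :
        (s * i + j) + (s * (t - 1 - i) + (s - n - j)) = k - 2 * n := by
      rw [Finset.mem_range] at hi hj
      have : s * t = s * i + s * (t - 1 - i) + s := by
        rw [← mul_add, ← Nat.mul_succ]; congr 1; omega
      omega
    rw [ht, Finset.sum_congr rfl fun w hw ↦ pow_sub_pow_div_sub_pow (hne w hw) hval t,
      Finset.sum_comm]
    refine Finset.sum_eq_zero fun i hi ↦ ?_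
    rw [Finset.sum_comm]
    refine Finset.sum_eq_zero fun j hj ↦ ?_
    rw [← Finset.mul_sum, ← hs, Finset.sum_erase,
      sum_product_pow_mul_pow_eq_zero φ S hsumS z (hexp hi hj) hN, mul_zero]
    have := hexp hi hj
    rcases Nat.eq_zero_or_pos (s * i + j) with h | h
    · have h' : s * (t - 1 - i) + (s - n - j) ≠ 0 := by omega
      simp [zero_pow h']
    · simp [zero_pow h.ne']
end

section
/- Let q = p^e be a prime power, let d ≥ 1 and ν ≥ 0 be integers, let m be a positive integer, and let ν₀ ≥ 0 be an integer with p^{ν₀} ∣ m. Set [d] := T^{q^d} − T ∈ A = 𝔽_q[T]. Then for every a ∈ A one has the divisibility [d]^{q^ν · p^{ν₀}} ∣ ( a^{m q^{d+ν}} − a^{m q^ν} ) in A. -/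
open Polynomial

/-- Over a finite field with `q` elements, substituting `X ^ q ^ d` for `X` is the same as
raising to the power `q ^ d`. -/
theorem expand_card_pow {F : Type*} [Field F] [Fintype F] (d : ℕ) (a : F[X]) :
    expand F (Fintype.card F ^ d) a = a ^ Fintype.card F ^ d := by
  induction d with
  | zero => simp
  | succ d ih => rw [pow_succ', expand_mul, ih, FiniteField.expand_card, ← pow_mul, mul_comm]

theorem X_pow_sub_X_dvd_expand_sub {R : Type*} [CommRing R] (n : ℕ) (a : R[X]) :
    X ^ n - X ∣ expand R n a - a := by
  have h := sub_dvd_eval_sub (X ^ n) X (a.map C)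
  rwa [eval_map, eval_map, eval₂_C_X] at h

/-- Let `q = p^e` be a prime power, `d ≥ 1`, `ν ≥ 0`, `m` a positive
integer, and `ν₀ ≥ 0` with `p^{ν₀} ∣ m`. With `[d] = T^{q^d} - T ∈ A = 𝔽_q[T]`, for every
`a ∈ A` one has `[d]^{q^ν p^{ν₀}} ∣ (a^{m q^{d+ν}} - a^{m q^ν})` in `A`. -/
theorem bracket_pow_dvd_frobenius_difference (p e : ℕ) (hp : p.Prime) (he : 0 < e)
    (F : Type*) [Field F] [Fintype F] (hcard : Fintype.card F = p ^ e)
    (d : ℕ) (hd : 1 ≤ d) (ν : ℕ)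
    (m : ℕ) (hm : 0 < m) (ν₀ : ℕ) (hν₀ : p ^ ν₀ ∣ m)
    (a : Polynomial F) :
    (X ^ (p ^ e) ^ d - X : Polynomial F) ^ ((p ^ e) ^ ν * p ^ ν₀) ∣
      a ^ (m * (p ^ e) ^ (d + ν)) - a ^ (m * (p ^ e) ^ ν) := by
  have := Fact.mk hp
  have : CharP F p := charP_of_card_eq_prime_pow hcard
  obtain ⟨k, rfl⟩ := hν₀
  have hdvd : (X ^ (p ^ e) ^ d - X : F[X]) ∣ (a ^ k) ^ (p ^ e) ^ d - a ^ k := by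
    rw [← hcard, ← expand_card_pow d (a ^ k)]
    exact X_pow_sub_X_dvd_expand_sub _ _
  have hpow : (p ^ e) ^ ν * p ^ ν₀ = p ^ (e * ν + ν₀) := by rw [← pow_mul, pow_add]
  have h := pow_dvd_pow_of_dvd hdvd (p ^ (e * ν + ν₀))
  rwa [sub_pow_char_pow ((a ^ k) ^ (p ^ e) ^ d), ← hpow, ← pow_mul (a ^ k), ← pow_mul a,
    ← pow_mul a,
    show k * ((p ^ e) ^ d * ((p ^ e) ^ ν * p ^ ν₀)) = p ^ ν₀ * k * (p ^ e) ^ (d + ν) by ring,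
    show k * ((p ^ e) ^ ν * p ^ ν₀) = p ^ ν₀ * k * (p ^ e) ^ ν by ring] at h
end
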